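/- Let U be a normal ultrafilter on a measurable cardinal δ. If κ > δ is the minimal cardinal with P(κ) ⊄ Ult(V,U), then there is an unbounded subset of κ that is fresh over Ult(V,U). -/

import Mathlib

noncomputable section

open Cardinal Set

namespace MU

/-- The type of ordinals below the initial ordinal of `δ`, serving as the underlying
set of the cardinal `δ` and indexing the ultrapower. -/
abbrev Idx (δ : Cardinal.{0}) : Type 1 := {o : Ordinal.{0} // o < δ.ord}

/-- A filter `F` is `κ`-complete (equivalently, `<κ`-closed): it is closed under
intersections of fewer than `κ` of its members. -/
def IsCComplete (κ : Cardinal.{0}) {X : Type*} (F : Filter X) : Prop :=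
  ∀ (ι : Type) (t : ι → Set X), #ι < κ → (∀ j, t j ∈ F) → (⋂ j, t j) ∈ F

/-- `U` is a normal ultrafilter on the measurable cardinal `δ`: `δ` is uncountable and
`U` is a `δ`-complete nonprincipal ultrafilter on `δ` such that every function that is
regressive on a set in `U` is constant on a set in `U`. -/
structure IsNormalUltrafilter (δ : Cardinal.{0}) (U : Ultrafilter (Idx δ)) : Prop where
  uncountable : ℵ₀ < δ
  complete : IsCComplete δ (U : Filter (Idx δ))
  nonprincipal : ∀ i : Idx δ, ({i} : Set (Idx δ)) ∉ U
  normal : ∀ f : Idx δ → Ordinal.{0}, { i : Idx δ | f i < i.1 } ∈ U →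
    ∃ c : Ordinal.{0}, { i : Idx δ | f i = c } ∈ U

variable {δ : Cardinal.{0}} {U : Ultrafilter (Idx δ)}

/-- The Łoś ordering on representatives of ordinals of the ultrapower `Ult(V,U)`. -/
def ultLT (U : Ultrafilter (Idx δ)) (f g : Idx δ → Ordinal.{0}) : Prop :=
  { i : Idx δ | f i < g i } ∈ U

theorem ultLT_wf (hU : IsNormalUltrafilter δ U) : WellFounded (ultLT U) := by
  haveI : IsIrrefl (Idx δ → Ordinal.{0}) (ultLT U) := by
    constructor
    intro f hf
    have h : ({ i : Idx δ | f i < f i } : Set (Idx δ)) = ∅ := by ext i; simp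
    rw [ultLT, h] at hf
    exact Filter.empty_notMem (U : Filter (Idx δ)) hf
  haveI : IsTrans (Idx δ → Ordinal.{0}) (ultLT U) := by
    constructor
    intro f g h hfg hgh
    have hsub : ({ i : Idx δ | f i < g i } ∩ { i : Idx δ | g i < h i } : Set (Idx δ)) ⊆
        { i : Idx δ | f i < h i } := fun i hi => show f i < h i from lt_trans hi.1 hi.2
    exact Filter.mem_of_superset (Filter.inter_mem hfg hgh) hsub
  haveI : IsStrictOrder (Idx δ → Ordinal.{0}) (ultLT U) := ⟨⟩
  rw [RelEmbedding.wellFounded_iff_isEmpty]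
  constructor
  intro g
  have hmem : ∀ n : ℕ, { i : Idx δ | g (n + 1) i < g n i } ∈ U :=
    fun n => g.map_rel_iff.2 (Nat.lt_succ_self n)
  have hint : (⋂ n : ℕ, { i : Idx δ | g (n + 1) i < g n i }) ∈ U := by
    refine hU.complete ℕ _ ?_ hmem
    rw [Cardinal.mk_nat]
    exact hU.uncountable
  obtain ⟨i, hi⟩ := Ultrafilter.nonempty_of_mem hint
  have hdesc : ∀ n : ℕ, (fun n => g n i) (n + 1) < (fun n => g n i) n :=
    fun n => Set.mem_iInter.1 hi n
  exact (RelEmbedding.wellFounded_iff_isEmpty.1 Ordinal.lt_wf).false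
    (RelEmbedding.natGT (fun n => g n i) hdesc)

/-- The ordinal represented by `f` in the transitive collapse of the ultrapower
`Ult(V,U)`, i.e. the rank of `f` in the (well-founded) Łoś ordering. -/
def ordRank (hU : IsNormalUltrafilter δ U) (f : Idx δ → Ordinal.{0}) : Ordinal.{0} :=
  sInf { o : Ordinal.{0} | Ordinal.lift.{1} o = ((ultLT_wf hU).apply f).rank }

/-- The image of an ordinal under the ultrapower embedding `j_U : V → Ult(V,U)`. -/
def jU (hU : IsNormalUltrafilter δ U) (o : Ordinal.{0}) : Ordinal.{0} :=
  ordRank hU fun _ => o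

/-- The set of ordinals that is the transitive collapse of the element of the
ultrapower `Ult(V,U)` represented by the function `f`. -/
def ultSet (hU : IsNormalUltrafilter δ U) (f : Idx δ → Set Ordinal.{0}) :
    Set Ordinal.{0} :=
  { o : Ordinal.{0} |
    ∃ g : Idx δ → Ordinal.{0}, { i : Idx δ | g i ∈ f i } ∈ U ∧ ordRank hU g = o }

/-- A set of ordinals is (the transitive collapse of) an element of the ultrapower
`Ult(V,U)`. -/
def InUlt (hU : IsNormalUltrafilter δ U) (A : Set Ordinal.{0}) : Prop :=
  ∃ f : Idx δ → Set Ordinal.{0}, (∀ i, BddAbove (f i)) ∧ A = ultSet hU f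

/-- The least upper bound of a set of ordinals. -/
def lub (A : Set Ordinal.{0}) : Ordinal.{0} :=
  sSup ((fun o => o + 1) '' A)

/-- Hamkins: a set `A` of ordinals is fresh over `Ult(V,U)` if `A ∉ Ult(V,U)` but
`A ∩ α ∈ Ult(V,U)` for every `α < lub A`. -/
def Fresh (hU : IsNormalUltrafilter δ U) (A : Set Ordinal.{0}) : Prop :=
  ¬ InUlt hU A ∧ ∀ α < lub A, InUlt hU (A ∩ Iio α)

/-- `A` is an unbounded subset of the ordinal `l`. -/
def UnbSub (A : Set Ordinal.{0}) (l : Ordinal.{0}) : Prop :=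
  A ⊆ Iio l ∧ ∀ b < l, ∃ a ∈ A, b ≤ a

/-- `A` is a closed subset of the ordinal `l`: it contains the suprema of all of its
nonempty subsets that are bounded below `l`. -/
def ClosedIn (A : Set Ordinal.{0}) (l : Ordinal.{0}) : Prop :=
  ∀ S ⊆ A, S.Nonempty → sSup S < l → sSup S ∈ A

/-- The set of limit points of a set of ordinals. -/
def limitPts (A : Set Ordinal.{0}) : Set Ordinal.{0} :=
  { b : Ordinal.{0} | (A ∩ Iio b).Nonempty ∧ sSup (A ∩ Iio b) = b }

/-- `S` is a stationary subset of the ordinal `l`. -/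
def StationaryIn (S : Set Ordinal.{0}) (l : Ordinal.{0}) : Prop :=
  S ⊆ Iio l ∧ ∀ D : Set Ordinal.{0}, ClosedIn D l → UnbSub D l → (S ∩ D).Nonempty

/-- The order type of the set of ordinals `C` is at most `o`. -/
def otpLE (C : Set Ordinal.{0}) (o : Ordinal.{0}) : Prop :=
  ∃ g : Ordinal.{0} → Ordinal.{0}, (∀ a ∈ C, g a < o) ∧
    ∀ a ∈ C, ∀ b ∈ C, a < b → g a < g b

/-- The order type of the set of ordinals `C` is (strictly) less than `o`. -/
def otpLT (C : Set Ordinal.{0}) (o : Ordinal.{0}) : Prop :=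
  ∃ o' < o, otpLE C o'

/-- `C` is a `□(Θ)`-sequence, where `Θ` is (the initial ordinal of) an uncountable
regular cardinal. -/
structure IsSquareSeq (Θ : Ordinal.{0}) (C : Ordinal.{0} → Set Ordinal.{0}) : Prop where
  closed : ∀ γ < Θ, Order.IsSuccLimit γ → ClosedIn (C γ) γ
  unbounded : ∀ γ < Θ, Order.IsSuccLimit γ → UnbSub (C γ) γ
  coherent : ∀ γ < Θ, Order.IsSuccLimit γ → ∀ β ∈ limitPts (C γ), β < γ → C β = C γ ∩ Iio β
  nontrivial : ¬ ∃ D : Set Ordinal.{0}, ClosedIn D Θ ∧ UnbSub D Θ ∧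
    ∀ γ ∈ limitPts D, γ < Θ → D ∩ Iio γ = C γ

/-- `C` is a `□_κ`-sequence: a `□(κ⁺)`-sequence all of whose clubs have order type
at most `κ`. -/
def IsSquareKappaSeq (κ : Cardinal.{0}) (C : Ordinal.{0} → Set Ordinal.{0}) : Prop :=
  IsSquareSeq (Order.succ κ).ord C ∧
    ∀ γ < (Order.succ κ).ord, Order.IsSuccLimit γ → otpLE (C γ) κ.ord

/-- `κ` is a weakly compact cardinal: `κ` is uncountable and every coloring of the
pairs of ordinals below `κ` in fewer than `κ` colors has a homogeneous set of size `κ`. -/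
def IsWeaklyCompact (κ : Cardinal.{0}) : Prop :=
  ℵ₀ < κ ∧ ∀ (ν : Type) (c : Ordinal.{0} → Ordinal.{0} → ν), #ν < κ →
    ∃ H : Set Ordinal.{0}, H ⊆ Iio κ.ord ∧ Cardinal.lift.{1} κ ≤ #H ∧
      ∀ a ∈ H, ∀ b ∈ H, ∀ a' ∈ H, ∀ b' ∈ H, a < b → a' < b' → c a b = c a' b'

/-- `κ` is a strongly compact cardinal: every `κ`-complete filter (on any set)
extends to a `κ`-complete ultrafilter. -/
def IsStronglyCompact (κ : Cardinal.{0}) : Prop :=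
  ∀ (X : Type) (F : Filter X), IsCComplete κ F →
    ∃ G : Ultrafilter X, F ≤ (G : Filter X) ∧ IsCComplete κ (G : Filter X)

/-- `κ` is a singular cardinal. -/
def IsSingular (κ : Cardinal.{0}) : Prop :=
  ℵ₀ ≤ κ ∧ κ.ord.cof < κ

/-- The cofinality of the ordinal `l` as computed inside the ultrapower `Ult(V,U)`
(as an ordinal, i.e. the image of the ultrapower's cofinality under the transitive
collapse). -/
def cofUlt (hU : IsNormalUltrafilter δ U) (l : Ordinal.{0}) : Ordinal.{0} :=
  sInf { c : Ordinal.{0} | ∃ f : Idx δ → Ordinal.{0},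
    ordRank hU f = l ∧ ordRank hU (fun i => ((f i).cof).ord) = c }

/-- The ordinal `o` is (the transitive collapse of) a cardinal of the ultrapower
`Ult(V,U)`. -/
def CardInUlt (hU : IsNormalUltrafilter δ U) (o : Ordinal.{0}) : Prop :=
  ∃ f : Idx δ → Ordinal.{0}, ordRank hU f = o ∧
    { i : Idx δ | ((f i).card).ord = f i } ∈ U

/-- The ordinal `o` is (the transitive collapse of) a regular cardinal of the
ultrapower `Ult(V,U)`. -/
def RegularInUlt (hU : IsNormalUltrafilter δ U) (o : Ordinal.{0}) : Prop :=
  ∃ f : Idx δ → Ordinal.{0}, ordRank hU f = o ∧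
    { i : Idx δ | ((f i).card).IsRegular ∧ ((f i).card).ord = f i } ∈ U

/-- The cardinal successor of the ordinal `o` as computed inside the ultrapower
`Ult(V,U)`: the least ordinal above `o` that is a cardinal in `Ult(V,U)`. -/
def succInUlt (hU : IsNormalUltrafilter δ U) (o : Ordinal.{0}) : Ordinal.{0} :=
  sInf { c : Ordinal.{0} | o < c ∧ CardInUlt hU c }

/-- The cardinality of a set of ordinals, as an (initial) ordinal: the least ordinal
`o` such that `s` is the image of a function defined on the ordinals below `o`. -/
def setCardOrd (s : Set Ordinal.{0}) : Ordinal.{0} :=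
  sInf { o : Ordinal.{0} | ∃ g : Ordinal.{0} → Ordinal.{0}, s ⊆ g '' Iio o }

section Ordinals

theorem exists_injective_pairing {o : Ordinal.{0}} (ho : Order.IsSuccLimit o) :
    ∃ p : Ordinal.{0} → Ordinal.{0} → Ordinal.{0}, (∀ x < o, ∀ y < o, p x y < o) ∧
      ∀ x < o, ∀ y < o, ∀ x' < o, ∀ y' < o, p x y = p x' y' → x = x' ∧ y = y' := by
  classical
  have hinf : ℵ₀ ≤ #(Iio o) := by
    rw [Cardinal.mk_Iio_ordinal, Cardinal.aleph0_le_lift, ← Ordinal.card_omega0]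
    exact Ordinal.card_le_card (Ordinal.omega0_le_of_isSuccLimit ho)
  have hcard : #(Iio o × Iio o) = #(Iio o) := by
    rw [← Cardinal.mul_def, Cardinal.mul_eq_self hinf]
  obtain ⟨e⟩ := Cardinal.eq.1 hcard
  refine ⟨fun x y => if h : x < o ∧ y < o then (e (⟨x, h.1⟩, ⟨y, h.2⟩)).1 else 0, ?_, ?_⟩
  · intro x hx y hy
    simp only [hx, hy, and_self, dite_true]
    exact (e _).2
  · intro x hx y hy x' hx' y' hy' h
    simp only [hx, hy, hx', hy', and_self, dite_true] at h
    have := e.injective (Subtype.ext h)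
    exact ⟨congrArg (fun z => z.1.1) this, congrArg (fun z => z.2.1) this⟩

theorem exists_lt_iff_of_wellFounded {r : Ordinal.{0} → Ordinal.{0} → Prop}
    (hr : WellFounded r) (hs : ∀ x, Small.{0} {y // r y x}) :
    ∃ h : Ordinal.{0} → Ordinal.{0}, ∀ x o, o < h x ↔ ∃ y, r y x ∧ o ≤ h y := by
  let h : Ordinal.{0} → Ordinal.{0} :=
    hr.fix fun x ih => ⨆ y : {y // r y x}, Order.succ (ih y.1 y.2)
  refine ⟨h, fun x o => ?_⟩
  have hx : h x = ⨆ y : {y // r y x}, Order.succ (h y.1) := hr.fix_eq _ x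
  rw [hx, Ordinal.lt_iSup_iff]
  simp

theorem exists_bijOn_Iio_card_ord (α : Ordinal.{0}) :
    ∃ h : Ordinal.{0} → Ordinal.{0}, BijOn h (Iio α.card.ord) (Iio α) := by
  have hcard : #(Iio α.card.ord) = #(Iio α) := by
    simp [Cardinal.mk_Iio_ordinal]
  obtain ⟨e⟩ := Cardinal.eq.1 hcard
  classical
  refine ⟨fun x => if h : x < α.card.ord then (e ⟨x, h⟩).1 else 0, ?_, ?_, ?_⟩
  · intro x hx
    simp only [mem_Iio.1 hx, dite_true]
    exact (e _).2
  · intro x hx y hy h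
    simp only [mem_Iio.1 hx, mem_Iio.1 hy, dite_true] at h
    exact congrArg Subtype.val (e.injective (Subtype.ext h))
  · intro y hy
    refine ⟨(e.symm ⟨y, hy⟩).1, (e.symm ⟨y, hy⟩).2, ?_⟩
    have hlt : (e.symm ⟨y, hy⟩).1 < α.card.ord := (e.symm ⟨y, hy⟩).2
    exact (dif_pos hlt).trans (congrArg Subtype.val (e.apply_symm_apply ⟨y, hy⟩))

theorem lub_eq_of_unbSub {A : Set Ordinal.{0}} {l : Ordinal.{0}} (hA : UnbSub A l) :
    lub A = l := by
  refine le_antisymm (csSup_le' ?_) (le_of_forall_lt fun b hb => ?_)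
  · rintro _ ⟨a, ha, rfl⟩
    exact Order.add_one_le_of_lt (hA.1 ha)
  · obtain ⟨a, ha, hba⟩ := hA.2 b hb
    have hbdd : BddAbove ((fun o : Ordinal.{0} => o + 1) '' A) := by
      refine ⟨l, ?_⟩
      rintro _ ⟨a, ha, rfl⟩
      exact Order.add_one_le_of_lt (hA.1 ha)
    exact (Order.lt_add_one_iff.2 hba).trans_le (le_csSup hbdd (mem_image_of_mem _ ha))

end Ordinals

section Ultrapower

variable (hU : IsNormalUltrafilter δ U)

instance : Small.{0} (Idx δ) := Ordinal.small_Iio δ.ord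

theorem ultLT_rank_congr {f g : Idx δ → Ordinal.{0}}
    (h : ∀ᶠ i in (U : Filter (Idx δ)), f i = g i) :
    ((ultLT_wf hU).apply f).rank = ((ultLT_wf hU).apply g).rank := by
  have key : ∀ k, ultLT U k f ↔ ultLT U k g := fun k =>
    Filter.eventually_congr (h.mono fun i hi => by rw [hi])
  rw [Acc.rank_eq, Acc.rank_eq]
  refine le_antisymm ?_ ?_ <;> rw [Ordinal.iSup_le_iff] <;> rintro ⟨k, hk⟩
  · exact Ordinal.le_iSup (fun b : {b // ultLT U b g} =>
      Order.succ (((ultLT_wf hU).apply g).inv b.2).rank) ⟨k, (key k).1 hk⟩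
  · exact Ordinal.le_iSup (fun b : {b // ultLT U b f} =>
      Order.succ (((ultLT_wf hU).apply f).inv b.2).rank) ⟨k, (key k).2 hk⟩

theorem exists_lift_eq_rank (f : Idx δ → Ordinal.{0}) :
    ∃ o : Ordinal.{0}, Ordinal.lift.{1} o = ((ultLT_wf hU).apply f).rank := by
  classical
  induction f using (ultLT_wf hU).induction with | _ f ih => ?_
  choose o ho using ih
  let F : (∀ i, Iic (f i)) → Ordinal.{0} := fun g =>
    if h : ultLT U (fun i => (g i).1) f then o _ h else 0
  suffices h : ((ultLT_wf hU).apply f).rank ≤ Ordinal.lift.{1} (⨆ g, Order.succ (F g)) from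
    Ordinal.mem_range_lift_of_le h
  rw [Acc.rank_eq, Ordinal.iSup_le_iff]
  rintro ⟨k, hk⟩
  let g : ∀ i, Iic (f i) := fun i => ⟨min (k i) (f i), mem_Iic.2 (min_le_right _ _)⟩
  have hgk : ∀ᶠ i in (U : Filter (Idx δ)), k i = (g i).1 :=
    Filter.Eventually.mono hk fun i (hi : k i < f i) => (min_eq_left hi.le).symm
  have hg : ultLT U (fun i => (g i).1) f :=
    Filter.Eventually.mono hk fun i (hi : k i < f i) => min_lt_of_left_lt hi
  have hF : F g = o _ hg := dif_pos hg
  change Order.succ ((ultLT_wf hU).apply k).rank ≤ _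
  rw [ultLT_rank_congr hU hgk, ← ho _ hg, ← hF, ← Ordinal.lift_succ, Ordinal.lift_le]
  exact Ordinal.le_iSup (fun g => Order.succ (F g)) g

theorem lift_ordRank (f : Idx δ → Ordinal.{0}) :
    Ordinal.lift.{1} (ordRank hU f) = ((ultLT_wf hU).apply f).rank :=
  csInf_mem (s := { o : Ordinal.{0} | Ordinal.lift.{1} o = ((ultLT_wf hU).apply f).rank })
    (exists_lift_eq_rank hU f)

theorem ordRank_congr {f g : Idx δ → Ordinal.{0}}
    (h : ∀ᶠ i in (U : Filter (Idx δ)), f i = g i) : ordRank hU f = ordRank hU g := by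
  rw [← Ordinal.lift_inj.{1, 0}, lift_ordRank, lift_ordRank, ultLT_rank_congr hU h]

theorem ordRank_lt_of_eventually {f g : Idx δ → Ordinal.{0}}
    (h : ∀ᶠ i in (U : Filter (Idx δ)), f i < g i) : ordRank hU f < ordRank hU g := by
  rw [← Ordinal.lift_lt.{1, 0}, lift_ordRank, lift_ordRank]
  exact Acc.rank_lt_of_rel ((ultLT_wf hU).apply g) h

theorem ordRank_lt_iff {f g : Idx δ → Ordinal.{0}} :
    ordRank hU f < ordRank hU g ↔ ∀ᶠ i in (U : Filter (Idx δ)), f i < g i := by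
  refine ⟨fun h => ?_, ordRank_lt_of_eventually hU⟩
  by_contra hn
  rw [← Ultrafilter.eventually_not] at hn
  rcases Ultrafilter.eventually_or.1 (hn.mono fun i hi => (not_lt.1 hi).lt_or_eq) with h' | h'
  · exact h.not_gt (ordRank_lt_of_eventually hU h')
  · exact h.ne' (ordRank_congr hU h')

theorem ordRank_le_iff {f g : Idx δ → Ordinal.{0}} :
    ordRank hU f ≤ ordRank hU g ↔ ∀ᶠ i in (U : Filter (Idx δ)), f i ≤ g i := by
  rw [← not_lt, ordRank_lt_iff, ← Ultrafilter.eventually_not]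
  simp only [not_lt]

theorem ordRank_eq_iff {f g : Idx δ → Ordinal.{0}} :
    ordRank hU f = ordRank hU g ↔ ∀ᶠ i in (U : Filter (Idx δ)), f i = g i := by
  simp only [le_antisymm_iff, ordRank_le_iff, Filter.eventually_and]

theorem ordRank_surjective : Function.Surjective (ordRank hU) := by
  intro o
  have hmono : StrictMono (jU hU) := fun a b hab =>
    ordRank_lt_of_eventually hU (Filter.Eventually.of_forall fun _ => hab)
  have hle : Ordinal.lift.{1} o ≤ ((ultLT_wf hU).apply fun _ => o).rank := by
    rw [← lift_ordRank, Ordinal.lift_le]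
    exact hmono.le_apply
  obtain ⟨g, _, hg⟩ := Acc.mem_range_rank_of_le _ hle
  exact ⟨g, Ordinal.lift_inj.{1, 0}.1 ((lift_ordRank hU g).trans hg)⟩

theorem ordRank_mem_ultSet_iff {g : Idx δ → Ordinal.{0}} {f : Idx δ → Set Ordinal.{0}} :
    ordRank hU g ∈ ultSet hU f ↔ ∀ᶠ i in (U : Filter (Idx δ)), g i ∈ f i := by
  refine ⟨?_, fun h => ⟨g, h, rfl⟩⟩
  rintro ⟨g', hg', h⟩
  filter_upwards [hg', (ordRank_eq_iff hU).1 h] with i hi hi'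
  exact hi' ▸ hi

theorem eventually_isSuccLimit {m : Idx δ → Ordinal.{0}}
    (hm : Order.IsSuccLimit (ordRank hU m)) :
    ∀ᶠ i in (U : Filter (Idx δ)), Order.IsSuccLimit (m i) := by
  by_contra hn
  rw [← Ultrafilter.eventually_not] at hn
  obtain ⟨z, hz⟩ := ordRank_surjective hU 0
  have hpos : ∀ᶠ i in (U : Filter (Idx δ)), z i < m i := by
    rw [← ordRank_lt_iff hU, hz]
    exact hm.bot_lt
  have hpred : ∀ᶠ i in (U : Filter (Idx δ)), ∃ p, p < m i ∧ m i ≤ Order.succ p := by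
    filter_upwards [hn, hpos] with i hi hi'
    by_contra! h
    refine hi ⟨fun hmin => ?_, Order.isSuccPrelimit_iff_succ_lt.2 h⟩
    exact (hmin.eq_bot ▸ hi').not_ge bot_le
  obtain ⟨p, hp⟩ := hpred.choice
  have hlt : ordRank hU p < ordRank hU m := (ordRank_lt_iff hU).2 (hp.mono fun _ h => h.1)
  obtain ⟨q, hq⟩ := ordRank_surjective hU (Order.succ (ordRank hU p))
  have hpq : ∀ᶠ i in (U : Filter (Idx δ)), p i < q i := by
    rw [← ordRank_lt_iff hU, hq]
    exact Order.lt_succ _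
  have hqm : ∀ᶠ i in (U : Filter (Idx δ)), q i < m i := by
    rw [← ordRank_lt_iff hU, hq]
    exact hm.succ_lt hlt
  obtain ⟨i, ⟨_, h1⟩, h2, h3⟩ := (hp.and (hpq.and hqm)).exists
  exact (h3.trans_le h1).not_ge (Order.succ_le_of_lt h2)

/-- If the power set of the cardinality of `α` is contained in the ultrapower, then `α` has the
same cardinality in the ultrapower, so that the power set of `α` is contained in it too. -/
theorem inUlt_of_subset_Iio {α : Ordinal.{0}} (hα : Ordinal.omega0 ≤ α)
    (hpow : ∀ A : Set Ordinal.{0}, A ⊆ Iio α.card.ord → InUlt hU A)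
    {X : Set Ordinal.{0}} (hX : X ⊆ Iio α) : InUlt hU X := by
  classical
  obtain ⟨h, hmaps, hinj, hsurj⟩ := exists_bijOn_Iio_card_ord α
  obtain ⟨m, hm⟩ := ordRank_surjective hU α.card.ord
  have hlim : Order.IsSuccLimit (ordRank hU m) := by
    rw [hm]
    refine Cardinal.isSuccLimit_ord ?_
    rw [← Ordinal.card_omega0]
    exact Ordinal.card_le_card hα
  have hpair : ∀ i, ∃ p : Ordinal.{0} → Ordinal.{0} → Ordinal.{0}, Order.IsSuccLimit (m i) →
      (∀ x < m i, ∀ y < m i, p x y < m i) ∧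
      ∀ x < m i, ∀ y < m i, ∀ x' < m i, ∀ y' < m i, p x y = p x' y' → x = x' ∧ y = y' := by
    intro i
    by_cases hi : Order.IsSuccLimit (m i)
    · obtain ⟨p, hp⟩ := exists_injective_pairing hi
      exact ⟨p, fun _ => hp⟩
    · exact ⟨fun _ _ => 0, fun h => absurd h hi⟩
  choose p hp using hpair
  have hp := (eventually_isSuccLimit hU hlim).mono hp
  have hlt : ∀ {f}, ordRank hU f < α.card.ord ↔
      ∀ᶠ i in (U : Filter (Idx δ)), f i < m i := by
    intro f
    rw [← hm, ordRank_lt_iff]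
  -- The ordering of type `α` on the cardinality of `α`, coded as a set of ordinals.
  obtain ⟨b, -, hb⟩ := hpow
    {o | ∃ f g, ordRank hU f < α.card.ord ∧ ordRank hU g < α.card.ord ∧
      h (ordRank hU f) < h (ordRank hU g) ∧ ordRank hU (fun i => p i (f i) (g i)) = o} (by
    rintro _ ⟨f, g, hf, hg, -, rfl⟩
    rw [mem_Iio, hlt]
    filter_upwards [hp, hlt.1 hf, hlt.1 hg] with i hi hfi hgi
    exact hi.1 _ hfi _ hgi)
  let r : Idx δ → Ordinal.{0} → Ordinal.{0} → Prop := fun i x y =>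
    x < m i ∧ y < m i ∧ p i x y ∈ b i
  have hr : ∀ f g, (∀ᶠ i in (U : Filter (Idx δ)), r i (f i) (g i)) ↔
      ordRank hU f < α.card.ord ∧ ordRank hU g < α.card.ord ∧
        h (ordRank hU f) < h (ordRank hU g) := by
    intro f g
    simp only [r, Filter.eventually_and, ← hlt]
    refine and_congr_right fun hf => and_congr_right fun hg => ?_
    rw [← ordRank_mem_ultSet_iff hU, ← hb]
    refine ⟨?_, fun hfg => ⟨f, g, hf, hg, hfg, rfl⟩⟩
    rintro ⟨f', g', hf', hg', hfg, heq⟩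
    have hboth : ∀ᶠ i in (U : Filter (Idx δ)), f' i = f i ∧ g' i = g i := by
      filter_upwards [hp, hlt.1 hf, hlt.1 hg, hlt.1 hf', hlt.1 hg', (ordRank_eq_iff hU).1 heq]
        with i hi h1 h2 h3 h4 h5
      exact hi.2 _ h3 _ h4 _ h1 _ h2 h5
    rw [Filter.eventually_and, ← ordRank_eq_iff hU, ← ordRank_eq_iff hU] at hboth
    rwa [hboth.1, hboth.2] at hfg
  have hwf : ∀ᶠ i in (U : Filter (Idx δ)), WellFounded (r i) := by
    by_contra hn
    rw [← Ultrafilter.eventually_not] at hn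
    have hS : ∀ i, ∃ S : Set Ordinal.{0}, ¬ WellFounded (r i) →
        S.Nonempty ∧ ∀ x ∈ S, ∃ y ∈ S, r i y x := by
      intro i
      by_cases hi : WellFounded (r i)
      · exact ⟨∅, fun h => absurd hi h⟩
      · have hi' := hi
        rw [WellFounded.wellFounded_iff_has_min] at hi'
        push Not at hi'
        obtain ⟨S, hS⟩ := hi'
        exact ⟨S, fun _ => hS⟩
    choose S hS using hS
    have hS := hn.mono hS
    obtain ⟨f₀, hf₀⟩ := (hS.mono fun i hi => hi.1).choice
    obtain ⟨f, hf, hmin⟩ := WellFounded.has_min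
      (InvImage.wf (fun f => h (ordRank hU f)) Ordinal.lt_wf)
      {f : Idx δ → Ordinal.{0} | ∀ᶠ i in (U : Filter (Idx δ)), f i ∈ S i} ⟨f₀, hf₀⟩
    obtain ⟨g, hg⟩ := ((hS.and hf).mono fun i hi => hi.1.2 _ hi.2).choice
    exact hmin g (hg.mono fun i hi => hi.1) ((hr g f).1 (hg.mono fun i hi => hi.2)).2.2
  have hk : ∀ i, ∃ k : Ordinal.{0} → Ordinal.{0}, WellFounded (r i) →
      ∀ x o, o < k x ↔ ∃ y, r i y x ∧ o ≤ k y := by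
    intro i
    by_cases hi : WellFounded (r i)
    · obtain ⟨k, hk⟩ := exists_lt_iff_of_wellFounded hi fun x =>
        small_subset (s := Iio (m i)) (t := {y | r i y x}) fun y (hy : r i y x) => mem_Iio.2 hy.1
      exact ⟨k, fun _ => hk⟩
    · exact ⟨id, fun h => absurd h hi⟩
  choose k hk using hk
  have hk := hwf.mono hk
  have hcollapse : ∀ f, ordRank hU f < α.card.ord →
      ordRank hU (fun i => k i (f i)) = h (ordRank hU f) := by
    intro f
    induction f using (InvImage.wf (fun f => h (ordRank hU f)) Ordinal.lt_wf).induction with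
    | _ f ih => ?_
    intro hf
    refine eq_of_forall_lt_iff fun o => ?_
    obtain ⟨g, rfl⟩ := ordRank_surjective hU o
    rw [ordRank_lt_iff]
    constructor
    · intro hlt'
      obtain ⟨y, hy⟩ := ((hk.and hlt').mono fun i hi => (hi.1 _ _).1 hi.2).choice
      obtain ⟨hyr, hyle⟩ := Filter.eventually_and.1 hy
      obtain ⟨h1, -, h2⟩ := (hr y f).1 hyr
      rw [← ordRank_le_iff hU, ih y h2 h1] at hyle
      exact hyle.trans_lt h2
    · intro hlt'
      obtain ⟨x, hx, hxg⟩ := hsurj (hlt'.trans (hmaps hf))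
      obtain ⟨y, rfl⟩ := ordRank_surjective hU x
      have hyf' : h (ordRank hU y) < h (ordRank hU f) := hxg ▸ hlt'
      have hyf := (hr y f).2 ⟨hx, hf, hyf'⟩
      have hle := (ordRank_le_iff hU).1 (hxg.symm.trans (ih y hyf' hx).symm).le
      filter_upwards [hk, hyf, hle] with i h1 h2 h3
      exact (h1 _ _).2 ⟨y i, h2, h3⟩
  obtain ⟨c, -, hc⟩ := hpow (Iio α.card.ord ∩ h ⁻¹' X) inter_subset_left
  refine ⟨fun i => k i '' (c i ∩ Iio (m i)), fun i => ?_, ?_⟩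
  · exact Ordinal.bddAbove_of_small
  · have hmem : ∀ {f}, (∀ᶠ i in (U : Filter (Idx δ)), f i ∈ c i) ↔
        ordRank hU f < α.card.ord ∧ h (ordRank hU f) ∈ X := by
      intro f
      rw [← ordRank_mem_ultSet_iff hU, ← hc]
      rfl
    ext o
    constructor
    · intro ho
      obtain ⟨x, hx, rfl⟩ := hsurj (hX ho)
      obtain ⟨f, rfl⟩ := ordRank_surjective hU x
      refine ⟨fun i => k i (f i), ?_, hcollapse f hx⟩
      filter_upwards [hmem.2 ⟨hx, ho⟩, hlt.1 hx] with i h1 h2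
      exact mem_image_of_mem _ ⟨h1, h2⟩
    · rintro ⟨g, hg, rfl⟩
      obtain ⟨f, hf⟩ := Filter.Eventually.choice (l := (U : Filter (Idx δ))) hg
      obtain ⟨h1, h2⟩ := hmem.1 (hf.mono fun i hi => hi.1.1)
      rwa [← ordRank_congr hU (hf.mono fun i hi => hi.2), hcollapse f h1]

end Ultrapower

/-- If `κ > δ` is the minimal cardinal whose power set is not contained in
`Ult(V,U)`, then there is an unbounded subset of `κ` that is fresh over `Ult(V,U)`. -/
theorem stmt3 (δ : Cardinal.{0}) (U : Ultrafilter (Idx δ)) (hU : IsNormalUltrafilter δ U)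
    (κ : Cardinal.{0}) (hδκ : δ < κ)
    (hnot : ¬ ∀ A : Set Ordinal.{0}, A ⊆ Iio κ.ord → InUlt hU A)
    (hmin : ∀ μ : Cardinal.{0}, μ < κ →
      ∀ A : Set Ordinal.{0}, A ⊆ Iio μ.ord → InUlt hU A) :
    ∃ A : Set Ordinal.{0}, UnbSub A κ.ord ∧ Fresh hU A := by
  push Not at hnot
  obtain ⟨A, hAκ, hA⟩ := hnot
  have hω : ℵ₀ < κ := hU.uncountable.trans hδκ
  have hinit : ∀ α < κ.ord, InUlt hU (A ∩ Iio α) := by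
    intro α hα
    have hmax : max α Ordinal.omega0 < κ.ord := max_lt hα (Cardinal.omega0_lt_ord.2 hω)
    exact inUlt_of_subset_Iio hU (le_max_right _ _) (hmin _ (Cardinal.lt_ord.1 hmax))
      fun a ha => lt_max_of_lt_left (mem_Iio.1 ha.2)
  have hunb : UnbSub A κ.ord := by
    refine ⟨hAκ, fun b hb => ?_⟩
    by_contra! h
    exact hA (inter_eq_left.2 h ▸ hinit b hb)
  exact ⟨A, hunb, hA, fun α hα => hinit α (lub_eq_of_unbSub hunb ▸ hα)⟩

end MU
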